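/- [Lemma 1] Assume a ≤ b·L or a·b·L ≤ σ² + Q_max·g_MB. Set ᾱ = min(L, a/b) and Q̄₂ = Q_max − (P_A·g_AM + σ²)·ᾱ². Then (ᾱ, Q̄₂) ∈ S and γ̂_B(ᾱ, Q̄₂) ≤ γ̂_B(α, Q₂) for every (α, Q₂) ∈ S; consequently the minimum achievable rate at Bob over S is r̂_B^min = r̂_B(ᾱ, Q̄₂). -/

import Mathlib

/-- On `0 ≤ x ≤ X ≤ a` with `a * X ≤ D`, the ratio `(a - x)² / (D - x²)` is smallest at `X`,
stated without division. -/
theorem sq_sub_mul_sub_sq_le {a x X D : ℝ} (hx : 0 ≤ x) (hxX : x ≤ X) (hXa : X ≤ a)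
    (hD : a * X ≤ D) :
    (a - X) ^ 2 * (D - x ^ 2) ≤ (a - x) ^ 2 * (D - X ^ 2) := by
  have h₁ : 0 ≤ (X - x) * ((D - a * X) * (2 * a - x - X)) :=
    mul_nonneg (by linarith) (mul_nonneg (by linarith) (by linarith))
  have h₂ : 0 ≤ (X - x) * (a * ((X - x) * (a - X))) :=
    mul_nonneg (by linarith) (mul_nonneg (by linarith)
      (mul_nonneg (by linarith) (by linarith)))
  linear_combination h₁ + h₂


/-- Lemma 1: the minimum achievable rate at Bob over the feasible set is
attained at ᾱ = min(L, a/b) with all remaining power spent on AN. -/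
theorem stmt_12
    (P_A P_R Q_max σ2 g_AR g_RB g_AM g_MB : ℝ)
    (hPA : 0 < P_A) (hPR : 0 < P_R) (hQmax : 0 < Q_max) (hσ2 : 0 < σ2)
    (hgAR : 0 < g_AR) (hgRB : 0 < g_RB) (hgAM : 0 < g_AM) (hgMB : 0 < g_MB)
    (a b L : ℝ)
    (ha : a = Real.sqrt (P_R * g_RB)) (hb : b = Real.sqrt (P_A * g_AM * g_MB))
    (hL : L = Real.sqrt (Q_max / (P_A * g_AM + σ2)))
    (γB rB' : ℝ → ℝ → ℝ)
    (hγB : ∀ α Q2, γB α Q2 = (a - b * α)^2 / (g_MB * Q2 + α^2 * g_MB * σ2 + σ2))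
    (hrB' : ∀ α Q2, rB' α Q2 = (1/2) * Real.logb 2 (1 + γB α Q2))
    (S : Set (ℝ × ℝ))
    (hS : S = {p : ℝ × ℝ | 0 ≤ p.1 ∧ 0 ≤ p.2 ∧
      p.1^2 * (P_A * g_AM + σ2) + p.2 ≤ Q_max})
    (hcase : a ≤ b * L ∨ a * b * L ≤ σ2 + Q_max * g_MB)
    (αbar Qbar2 : ℝ)
    (hαbar : αbar = min L (a / b))
    (hQbar2 : Qbar2 = Q_max - (P_A * g_AM + σ2) * αbar^2) :
    (αbar, Qbar2) ∈ S ∧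
      (∀ α Q2 : ℝ, (α, Q2) ∈ S → γB αbar Qbar2 ≤ γB α Q2) ∧
      (∀ α Q2 : ℝ, (α, Q2) ∈ S → rB' αbar Qbar2 ≤ rB' α Q2) := by
  have hc : 0 < P_A * g_AM + σ2 := by positivity
  have ha0 : 0 < a := by rw [ha]; positivity
  have hb0 : 0 < b := by rw [hb]; positivity
  have hL0 : 0 < L := by rw [hL]; positivity
  have hbsq : b ^ 2 = P_A * g_AM * g_MB := by rw [hb]; exact Real.sq_sqrt (by positivity)
  have hLsq : (P_A * g_AM + σ2) * L ^ 2 = Q_max := by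
    rw [hL, Real.sq_sqrt (by positivity)]
    field_simp
  have hα0 : 0 ≤ αbar := by rw [hαbar]; positivity
  have hαL : αbar ≤ L := hαbar ▸ min_le_left _ _
  have hQ0 : 0 ≤ Qbar2 := by
    have : (P_A * g_AM + σ2) * αbar ^ 2 ≤ (P_A * g_AM + σ2) * L ^ 2 := by gcongr
    linarith
  have hden : ∀ α Q2 : ℝ, 0 ≤ Q2 → 0 < g_MB * Q2 + α ^ 2 * g_MB * σ2 + σ2 := by
    intro α Q2 hQ
    positivity
  have hγ0 : ∀ α Q2 : ℝ, 0 ≤ Q2 → 0 ≤ γB α Q2 := by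
    intro α Q2 hQ
    rw [hγB]
    exact div_nonneg (sq_nonneg _) (hden α Q2 hQ).le
  have hγ : ∀ α Q2 : ℝ, (α, Q2) ∈ S → γB αbar Qbar2 ≤ γB α Q2 := by
    intro α Q2 hmem
    rw [hS] at hmem
    obtain ⟨hα, hQ, hpow⟩ : 0 ≤ α ∧ 0 ≤ Q2 ∧ α ^ 2 * (P_A * g_AM + σ2) + Q2 ≤ Q_max := hmem
    by_cases hab : a ≤ b * L
    · have hαeq : αbar = a / b := by
        rw [hαbar, min_eq_right]
        rwa [div_le_iff₀' hb0]
      have hzero : γB αbar Qbar2 = 0 := by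
        rw [hγB, hαeq, mul_div_cancel₀ _ hb0.ne']
        simp
      exact hzero ▸ hγ0 α Q2 hQ
    · have hD := hcase.resolve_left hab
      push Not at hab
      have hαeq : αbar = L := by
        rw [hαbar, min_eq_left]
        rw [le_div_iff₀' hb0]
        exact hab.le
      have hαle : α ≤ L := by
        have hsq : (P_A * g_AM + σ2) * α ^ 2 ≤ (P_A * g_AM + σ2) * L ^ 2 := by linarith
        exact le_of_sq_le_sq (le_of_mul_le_mul_left hsq hc) hL0.le
      have key := sq_sub_mul_sub_sq_le (mul_nonneg hb0.le hα)
        (mul_le_mul_of_nonneg_left hαle hb0.le) hab.le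
        (show a * (b * L) ≤ σ2 + Q_max * g_MB by linarith)
      have hden_le : g_MB * Q2 + α ^ 2 * g_MB * σ2 + σ2
          ≤ σ2 + Q_max * g_MB - (b * α) ^ 2 := by
        rw [mul_pow, hbsq]
        linear_combination g_MB * hpow
      have hden_eq : g_MB * Qbar2 + αbar ^ 2 * g_MB * σ2 + σ2
          = σ2 + Q_max * g_MB - (b * αbar) ^ 2 := by
        rw [mul_pow, hbsq, hQbar2]
        ring
      rw [hγB, hγB, div_le_div_iff₀ (hden _ _ hQ0) (hden _ _ hQ), hden_eq, hαeq]
      exact (mul_le_mul_of_nonneg_left hden_le (sq_nonneg _)).trans key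
  refine ⟨?_, hγ, ?_⟩
  · rw [hS]
    refine ⟨hα0, hQ0, ?_⟩
    simp only [hQbar2]
    linarith
  · intro α Q2 hmem
    have h := hγ α Q2 hmem
    have h0 := hγ0 αbar Qbar2 hQ0
    rw [hrB', hrB']
    gcongr
    norm_num
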